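/- arXiv:2509.17820 — 2 statements merged into one kernel-verified Lean document; each statement's English description precedes it below -/
import Mathlib

section
/- Let P be a finite poset whose largest antichain has size at most a. Then P can be partitioned into at most a chains. -/
theorem dil_aux {P : Type*} [PartialOrder P] (S : Finset P) : ∀ (a : ℕ)
    (_ : ∀ A : Finset P, A ⊆ S → IsAntichain (· ≤ ·) (A : Set P) → A.card ≤ a),
    ∃ c : P → ℕ, (∀ x ∈ S, c x < a) ∧
      ∀ x ∈ S, ∀ y ∈ S, c x = c y → x ≤ y ∨ y ≤ x := by
  classical
  induction S using Finset.strongInduction with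
  | H S ih =>
  intro a h
  rcases S.eq_empty_or_nonempty with rfl | hne
  · exact ⟨fun _ => 0, by simp, by simp⟩
  obtain ⟨m, hm⟩ := S.exists_maximal hne
  have hmS : m ∈ S := hm.1
  obtain ⟨b, rfl⟩ : ∃ b, a = b + 1 := by
    have := h {m} (by simpa using hmS) (by simp)
    simp at this
    exact ⟨a - 1, by omega⟩
  -- finishing step
  have key : ∀ K : Finset P, m ∈ K → (∀ x ∈ K, ∀ y ∈ K, x ≤ y ∨ y ≤ x) →
      (∀ A : Finset P, A ⊆ S \ K → IsAntichain (· ≤ ·) (A : Set P) → A.card ≤ b) →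
      ∃ c : P → ℕ, (∀ x ∈ S, c x < b + 1) ∧
      ∀ x ∈ S, ∀ y ∈ S, c x = c y → x ≤ y ∨ y ≤ x := by
    intro K hmK hK hw
    obtain ⟨c, hc1, hc2⟩ := ih (S \ K) (by
      refine Finset.ssubset_iff_subset_ne.2 ⟨Finset.sdiff_subset, fun e => ?_⟩
      rw [← e] at hmS
      exact (Finset.mem_sdiff.1 hmS).2 hmK) b hw
    refine ⟨fun x => if x ∈ K then b else c x, ?_, ?_⟩
    · intro x hx
      by_cases hxK : x ∈ K
      · simp [hxK]
      · have := hc1 x (Finset.mem_sdiff.2 ⟨hx, hxK⟩)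
        simp only [hxK, if_false]; omega
    · intro x hx y hy
      by_cases hxK : x ∈ K <;> by_cases hyK : y ∈ K <;> simp only [hxK, hyK, if_true, if_false]
      · exact fun _ => hK x hxK y hyK
      · have := hc1 y (Finset.mem_sdiff.2 ⟨hy, hyK⟩)
        intro e; omega
      · have := hc1 x (Finset.mem_sdiff.2 ⟨hx, hxK⟩)
        intro e; omega
      · exact hc2 x (Finset.mem_sdiff.2 ⟨hx, hxK⟩) y (Finset.mem_sdiff.2 ⟨hy, hyK⟩)
  by_cases hw : ∀ A : Finset P, A ⊆ S \ {m} → IsAntichain (· ≤ ·) (A : Set P) → A.card ≤ b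
  · exact key {m} (by simp) (by simp) hw
  push Not at hw
  obtain ⟨B₀, hB₀S, hB₀, hB₀c⟩ := hw
  obtain ⟨c, hc1, hc2⟩ := ih (S \ {m}) (by
      refine Finset.ssubset_iff_subset_ne.2 ⟨Finset.sdiff_subset, fun e => ?_⟩
      rw [← e] at hmS
      simp at hmS) (b + 1) (fun A hA => h A (hA.trans Finset.sdiff_subset))
  -- antichains of full size hit every colour
  have hit : ∀ B : Finset P, B ⊆ S \ {m} → IsAntichain (· ≤ ·) (B : Set P) → b < B.card →
      ∀ i < b + 1, ∃ y ∈ B, c y = i := by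
    intro B hBS hB hBc i hi
    have hinj : Set.InjOn c (B : Set P) := by
      intro x hx y hy e
      rcases hc2 x (hBS hx) y (hBS hy) e with h1 | h1
      · exact hB.eq hx hy h1
      · exact (hB.eq hy hx h1).symm
    have himg : B.image c = Finset.range (b + 1) := by
      apply Finset.eq_of_subset_of_card_le
      · intro j hj
        obtain ⟨y, hy, rfl⟩ := Finset.mem_image.1 hj
        exact Finset.mem_range.2 (hc1 y (hBS hy))
      · rw [Finset.card_image_of_injOn hinj, Finset.card_range]; omega
    have : i ∈ B.image c := by rw [himg]; exact Finset.mem_range.2 hi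
    simpa using this
  let Q : P → Prop := fun x => ∃ B : Finset P, B ⊆ S \ {m} ∧ IsAntichain (· ≤ ·) (B : Set P) ∧
    b < B.card ∧ x ∈ B
  have hx : ∀ i : ℕ, ∃ x : P, i < b + 1 → (x ∈ S \ {m} ∧ c x = i ∧ Q x ∧
      ∀ y, c y = i → Q y → y ≤ x) := by
    intro i
    by_cases hi : i < b + 1
    · obtain ⟨y, hy, hyi⟩ := hit B₀ hB₀S hB₀ hB₀c i hi
      obtain ⟨x, hxm⟩ := ((S \ {m}).filter (fun x => c x = i ∧ Q x)).exists_maximal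
        ⟨y, Finset.mem_filter.2 ⟨hB₀S hy, hyi, B₀, hB₀S, hB₀, hB₀c, hy⟩⟩
      have hx1 := Finset.mem_filter.1 hxm.1
      refine ⟨x, fun _ => ⟨hx1.1, hx1.2.1, hx1.2.2, fun z hz hQ => ?_⟩⟩
      have hzS : z ∈ S \ {m} := by
        obtain ⟨B, h1, _, _, h2⟩ := hQ
        exact h1 h2
      rcases hc2 z hzS x hx1.1 (hz.trans hx1.2.1.symm) with h1 | h1
      · exact h1
      · exact hxm.2 (Finset.mem_filter.2 ⟨hzS, hz, hQ⟩) h1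
    · exact ⟨m, fun h => absurd h hi⟩
  choose x hx using hx
  have hanti : ∀ i < b + 1, ∀ j < b + 1, x i ≤ x j → i = j := by
    intro i hi j hj hij
    obtain ⟨B, hBS, hB, hBc, hjB⟩ := (hx j hj).2.2.1
    obtain ⟨y, hy, hyi⟩ := hit B hBS hB hBc i hi
    have h1 : y ≤ x i := (hx i hi).2.2.2 y hyi ⟨B, hBS, hB, hBc, hy⟩
    have h2 : y = x j := hB.eq hy hjB (h1.trans hij)
    rw [← hyi, h2, (hx j hj).2.1]
  obtain ⟨i, hi, him⟩ : ∃ i < b + 1, x i ≤ m := by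
    by_contra hno
    push Not at hno
    have hmn : m ∉ (Finset.range (b + 1)).image x := by
      intro hmem
      obtain ⟨i, hi, e⟩ := Finset.mem_image.1 hmem
      exact hno i (Finset.mem_range.1 hi) e.le
    have hcard : ((Finset.range (b + 1)).image x).card = b + 1 := by
      rw [Finset.card_image_of_injOn, Finset.card_range]
      intro i hi j hj e
      exact hanti i (by simpa using hi) j (by simpa using hj) e.le
    have := h (insert m ((Finset.range (b + 1)).image x)) (by
      intro z hz
      rcases Finset.mem_insert.1 hz with rfl | hz
      · exact hmS
      · obtain ⟨i, hi, rfl⟩ := Finset.mem_image.1 hz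
        exact (Finset.mem_sdiff.1 (hx i (Finset.mem_range.1 hi)).1).1) (by
      intro u hu v hv huv hle
      rcases Finset.mem_insert.1 hu with rfl | hu2 <;> rcases Finset.mem_insert.1 hv with rfl | hv2
      · exact huv rfl
      · obtain ⟨i, hi, rfl⟩ := Finset.mem_image.1 hv2
        have hi := Finset.mem_range.1 hi
        exact hno i hi (hm.2 (Finset.mem_sdiff.1 (hx i hi).1).1 hle)
      · obtain ⟨i, hi, rfl⟩ := Finset.mem_image.1 hu2
        exact hno i (Finset.mem_range.1 hi) hle
      · obtain ⟨i, hi, rfl⟩ := Finset.mem_image.1 hu2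
        obtain ⟨j, hj, rfl⟩ := Finset.mem_image.1 hv2
        exact huv (by rw [hanti i (Finset.mem_range.1 hi) j (Finset.mem_range.1 hj) hle]))
    rw [Finset.card_insert_of_notMem hmn, hcard] at this
    omega
  refine key (insert m ((S \ {m}).filter (fun z => c z = i ∧ z ≤ x i))) (by simp) ?_ ?_
  · intro u hu v hv
    rcases Finset.mem_insert.1 hu with rfl | hu <;> rcases Finset.mem_insert.1 hv with rfl | hv
    · exact Or.inl le_rfl
    · exact Or.inr ((Finset.mem_filter.1 hv).2.2.trans him)
    · exact Or.inl ((Finset.mem_filter.1 hu).2.2.trans him)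
    · have hu := Finset.mem_filter.1 hu
      have hv := Finset.mem_filter.1 hv
      exact hc2 u hu.1 v hv.1 (hu.2.1.trans hv.2.1.symm)
  · intro B hBS hB
    by_contra hBc
    have hBc : b < B.card := not_le.1 hBc
    have hBS' : B ⊆ S \ {m} := by
      intro z hz
      have := Finset.mem_sdiff.1 (hBS hz)
      refine Finset.mem_sdiff.2 ⟨this.1, fun e => this.2 ?_⟩
      rw [Finset.mem_singleton.1 e]
      exact Finset.mem_insert_self _ _
    obtain ⟨y, hy, hyi⟩ := hit B hBS' hB hBc i hi
    refine (Finset.mem_sdiff.1 (hBS hy)).2 (Finset.mem_insert_of_mem ?_)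
    exact Finset.mem_filter.2 ⟨hBS' hy, hyi, (hx i hi).2.2.2 y hyi ⟨B, hBS', hB, hBc, hy⟩⟩

/-- Dilworth's theorem: if every antichain of a finite poset `P` has size at most `a`,
then `P` can be partitioned into at most `a` chains. -/
theorem stmt_2 (P : Type*) [Fintype P] [PartialOrder P] (a : ℕ)
    (h : ∀ A : Finset P, IsAntichain (· ≤ ·) (A : Set P) → A.card ≤ a) :
    ∃ c : P → Fin a, ∀ i : Fin a, IsChain (· ≤ ·) {x : P | c x = i} := by
  obtain ⟨c, h1, h2⟩ := dil_aux (Finset.univ : Finset P) a (fun A _ => h A)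
  refine ⟨fun x => ⟨c x, h1 x (Finset.mem_univ x)⟩, fun i x hx y hy _ => ?_⟩
  apply h2 x (Finset.mem_univ x) y (Finset.mem_univ y)
  have hx' := congrArg Fin.val hx
  have hy' := congrArg Fin.val hy
  exact hx'.trans hy'.symm
end

section
/- There is a constant C > 0 such that for every n ≥ 1 there exists a family V ⊆ 2^[n] with |V| ≤ 2^{2n/3 + C√n} such that every n-element poset embeds as an induced subposet of (V, ⊆). -/
theorem dilworth_aux {P : Type} [PartialOrder P] [DecidableEq P] :
    ∀ (m : ℕ) (S : Finset P), S.card = m → ∀ w : ℕ,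
      (∀ A : Finset P, A ⊆ S → IsAntichain (· ≤ ·) (A : Set P) → A.card ≤ w) →
      ∃ col : P → ℕ, (∀ x ∈ S, col x < w) ∧
        ∀ x ∈ S, ∀ y ∈ S, col x = col y → x ≤ y ∨ y ≤ x := by
  classical
  intro m
  induction m using Nat.strong_induction_on with
  | _ m ih =>
  intro S hS w hw
  rcases S.eq_empty_or_nonempty with rfl | hne
  · exact ⟨fun _ => 0, by simp, by simp⟩
  obtain ⟨a, ha⟩ := S.exists_maximal hne
  have haS : a ∈ S := ha.1
  have hamax : ∀ x ∈ S, a ≤ x → x = a := fun x hx h => le_antisymm (ha.2 hx h) h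
  set S' := S.erase a with hS'
  have hSS : S' ⊆ S := Finset.erase_subset _ _
  -- width of S'
  let AC : Finset (Finset P) := S'.powerset.filter (fun A : Finset P => IsAntichain (· ≤ ·) (A : Set P))
  have hAC : ∀ A, A ∈ AC ↔ A ⊆ S' ∧ IsAntichain (· ≤ ·) (A : Set P) := by
    intro A; simp [AC]
  obtain ⟨A0, hA0, hmax⟩ := AC.exists_max_image Finset.card ⟨∅, by simp [hAC]⟩
  set k := A0.card with hk
  rw [hAC] at hA0
  have hcard' : S'.card < m := by
    rw [← hS]; exact Finset.card_erase_lt_of_mem haS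
  obtain ⟨col, hc1, hc2⟩ := ih _ hcard' S' rfl k (fun A h1 h2 => hmax A ((hAC A).2 ⟨h1, h2⟩))
  have hkw : k ≤ w := hw A0 (hA0.1.trans hSS) hA0.2
  -- each k-antichain hits each colour
  have hit : ∀ A, A ⊆ S' → IsAntichain (· ≤ ·) (A : Set P) → A.card = k → ∀ i < k,
      ∃ z ∈ A, col z = i := by
    intro A h1 h2 h3 i hi
    have hinj : Set.InjOn col (A : Set P) := by
      intro x hx y hy hxy
      by_contra hne
      rcases hc2 x (h1 hx) y (h1 hy) hxy with h | h
      · exact h2 hx hy hne h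
      · exact h2 hy hx (Ne.symm hne) h
    have : A.image col = Finset.range k := by
      apply Finset.eq_of_subset_of_card_le
      · intro j hj
        obtain ⟨z, hz, rfl⟩ := Finset.mem_image.1 hj
        exact Finset.mem_range.2 (hc1 z (h1 hz))
      · rw [Finset.card_image_of_injOn hinj, h3, Finset.card_range]
    have h4 : i ∈ A.image col := by rw [this]; exact Finset.mem_range.2 hi
    obtain ⟨z, hz, h⟩ := Finset.mem_image.1 h4
    exact ⟨z, hz, h⟩
  let good : P → Prop := fun z => ∃ A, A ⊆ S' ∧ IsAntichain (· ≤ ·) (A : Set P) ∧ A.card = k ∧ z ∈ A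
  have hx : ∀ i, ∃ x, i < k → (x ∈ S' ∧ col x = i ∧ good x ∧
      ∀ z ∈ S', col z = i → good z → z ≤ x) := by
    intro i
    by_cases hi : i < k
    swap
    · exact ⟨a, fun h => absurd h hi⟩
    obtain ⟨z0, hz0, hz0'⟩ := hit A0 hA0.1 hA0.2 rfl i hi
    obtain ⟨x, hx⟩ := (S'.filter (fun z => col z = i ∧ good z)).exists_maximal
      ⟨z0, by simpa using ⟨hA0.1 hz0, hz0', A0, hA0.1, hA0.2, rfl, hz0⟩⟩
    have hx1 := Finset.mem_filter.1 hx.1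
    refine ⟨x, fun _ => ⟨hx1.1, hx1.2.1, hx1.2.2, ?_⟩⟩
    intro z hz hz1 hz2
    rcases hc2 z hz x hx1.1 (by rw [hz1, hx1.2.1]) with h | h
    · exact h
    · exact hx.2 (Finset.mem_filter.2 ⟨hz, hz1, hz2⟩) h
  choose x hx using hx
  have hanti : ∀ i < k, ∀ j < k, i ≠ j → ¬ x i ≤ x j := by
    intro i hi j hj hij hle
    obtain ⟨-, hcj, ⟨A, h1, h2, h3, h4⟩, -⟩ := hx j hj
    obtain ⟨y, hy, hyc⟩ := hit A h1 h2 h3 i hi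
    have h5 := (hx i hi).2.2.2 y (h1 hy) hyc ⟨A, h1, h2, h3, hy⟩
    have hne : y ≠ x j := by
      intro h; apply hij; rw [← hyc, h, hcj]
    exact h2 hy h4 hne (h5.trans hle)
  by_cases hcase : ∃ i < k, x i ≤ a
  · obtain ⟨i, hi, hia⟩ := hcase
    obtain ⟨hxS, hxc, -, hxm⟩ := hx i hi
    let S2 := S'.filter (fun z => ¬ (col z = i ∧ z ≤ x i))
    have hS2 : S2 ⊆ S' := Finset.filter_subset _ _
    obtain ⟨col2, hd1, hd2⟩ := ih S2.card ((Finset.card_le_card hS2).trans_lt hcard') S2 rfl (k-1) (by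
      intro B hB hB2
      have h1 : B.card ≤ k := hmax B ((hAC B).2 ⟨hB.trans hS2, hB2⟩)
      by_contra hcon
      have h2 : B.card = k := by omega
      obtain ⟨z, hz, hzc⟩ := hit B (hB.trans hS2) hB2 h2 i hi
      have h3 := hxm z (hS2 (hB hz)) hzc ⟨B, hB.trans hS2, hB2, h2, hz⟩
      exact (Finset.mem_filter.1 (hB hz)).2 ⟨hzc, h3⟩)
    have hK : ∀ y ∈ S, y ∉ S2 → y = a ∨ (y ∈ S' ∧ col y = i ∧ y ≤ x i) := by
      intro y hy hy2
      by_cases hya : y = a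
      · exact Or.inl hya
      · have : y ∈ S' := Finset.mem_erase.2 ⟨hya, hy⟩
        by_contra hcon
        push Not at hcon
        exact hy2 (Finset.mem_filter.2 ⟨this, fun h => hcon.2 this h.1 h.2⟩)
    refine ⟨fun y => if y ∈ S2 then col2 y else k - 1, ?_, ?_⟩
    · intro y hy
      by_cases h : y ∈ S2
      · simp only [h, if_true]
        have := hd1 y h; omega
      · simp only [h, if_false]; omega
    · intro y hy z hz hyz
      by_cases h : y ∈ S2 <;> by_cases h' : z ∈ S2 <;> simp only [h, h', if_true, if_false] at hyz
      · exact hd2 y h z h' hyz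
      · have := hd1 y h; omega
      · have := hd1 z h'; omega
      · rcases hK y hy h with rfl | ⟨h1, h2, h3⟩ <;> rcases hK z hz h' with rfl | ⟨h4, h5, h6⟩
        · exact Or.inl le_rfl
        · exact Or.inr (h6.trans hia)
        · exact Or.inl (h3.trans hia)
        · exact hc2 y h1 z h4 (by rw [h2, h5])
  · push Not at hcase
    have hk1 : k + 1 ≤ w := by
      have hinj : Set.InjOn x (Finset.range k : Set ℕ) := by
        intro i hi j hj hij
        by_contra hne
        exact hanti i (by simpa using hi) j (by simpa using hj) hne hij.le
      have hB := hw (insert a ((Finset.range k).image x)) (by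
        intro y hy
        rcases Finset.mem_insert.1 hy with rfl | hy
        · exact haS
        · obtain ⟨i, hi, rfl⟩ := Finset.mem_image.1 hy
          exact hSS (hx i (Finset.mem_range.1 hi)).1) (by
        intro y hy z hz hne hle
        simp only [Finset.coe_insert, Finset.coe_image, Set.mem_insert_iff, Set.mem_image, Finset.coe_range, Set.mem_Iio] at hy hz
        rcases hy with rfl | ⟨i, hi, rfl⟩ <;> rcases hz with rfl | ⟨j, hj, rfl⟩
        · exact hne rfl
        · exact hne (hamax _ (hSS (hx j hj).1) hle).symm
        · exact hcase i hi hle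
        · exact hanti i hi j hj (fun h => hne (by rw [h])) hle)
      rw [Finset.card_insert_of_notMem, Finset.card_image_of_injOn hinj, Finset.card_range] at hB
      · exact hB
      · intro h
        obtain ⟨i, hi, h⟩ := Finset.mem_image.1 h
        exact hcase i (Finset.mem_range.1 hi) h.le
    refine ⟨fun y => if y = a then k else col y, ?_, ?_⟩
    · intro y hy
      by_cases h : y = a
      · simp only [h, if_true]; omega
      · simp only [h, if_false]
        have := hc1 y (Finset.mem_erase.2 ⟨h, hy⟩); omega
    · intro y hy z hz hyz
      by_cases h : y = a <;> by_cases h' : z = a <;> simp only [h, h', if_true, if_false] at hyz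
      · left; rw [h, h']
      · have := hc1 z (Finset.mem_erase.2 ⟨h', hz⟩); omega
      · have := hc1 y (Finset.mem_erase.2 ⟨h, hy⟩); omega
      · exact hc2 y (Finset.mem_erase.2 ⟨h, hy⟩) z (Finset.mem_erase.2 ⟨h', hz⟩) hyz

theorem split_aux {P : Type} [DecidableEq P] : ∀ (m : ℕ) (S : Finset P), S.card = m →
    ∃ Q : Finpartition S, (∀ p ∈ Q.parts, p.card ≤ 8) ∧
      16 * 3 ^ m * ∏ p ∈ Q.parts, (p.card + 1) ≤ 27 * 4 ^ m := by
  intro m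
  induction m using Nat.strong_induction_on with
  | _ m ih =>
  intro S hS
  by_cases h8 : m ≤ 8
  · rcases S.eq_empty_or_nonempty with rfl | hne
    · refine ⟨Finpartition.empty _, by simp [Finpartition.empty], ?_⟩
      simp at hS
      subst hS
      simp [Finpartition.empty]
    · refine ⟨Finpartition.indiscrete hne.ne_empty, by simp [hS, h8], ?_⟩
      simp only [Finpartition.indiscrete_parts, Finset.prod_singleton, hS]
      interval_cases m <;> norm_num
  · obtain ⟨T, hT, hTc⟩ := Finset.exists_subset_card_eq (s := S) (n := 8) (by omega)
    have hc : (S \ T).card = m - 8 := by rw [Finset.card_sdiff_of_subset hT]; omega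
    obtain ⟨Q, h1, h2⟩ := ih (m-8) (by omega) (S \ T) hc
    have hTne : T ≠ ⊥ := by rintro rfl; simp at hTc
    refine ⟨Q.extend hTne Finset.sdiff_disjoint (by simp [hT]), ?_, ?_⟩
    · intro p hp
      rcases Finset.mem_insert.1 hp with rfl | hp
      · omega
      · exact h1 p hp
    · have hnot : T ∉ Q.parts := by
        intro h
        have := Q.le h
        exact hTne (Finset.sdiff_disjoint.symm.eq_bot_of_le this)
      simp only [Finpartition.extend_parts]
      rw [Finset.prod_insert hnot, hTc]
      obtain ⟨r, rfl⟩ : ∃ r, m = r + 8 := ⟨m - 8, by omega⟩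
      simp only [Nat.add_sub_cancel] at h2
      rw [pow_add, pow_add]
      nlinarith [Nat.zero_le (4 ^ r)]

theorem decomp {P : Type} [Fintype P] [PartialOrder P] [DecidableEq P] (n w : ℕ)
    (hn : Fintype.card P = n) (hnw : n ≤ 3 * w)
    (hw : ∀ A : Finset P, IsAntichain (· ≤ ·) (A : Set P) → A.card ≤ w) :
    ∃ (ι : Type) (_ : Fintype ι) (S : ι → Finset P) (g : P → ι),
      (∀ x i, x ∈ S i ↔ g x = i) ∧ (∀ x y, g x = g y → x ≤ y ∨ y ≤ x) ∧
      (∀ i, (S i).card ≤ 8) ∧ Fintype.card ι ≤ n ∧ ∏ i, ((S i).card + 1) ≤ 4 ^ w := by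
  classical
  obtain ⟨col, h1, h2⟩ := dilworth_aux _ (Finset.univ : Finset P) rfl w (fun A _ h => hw A h)
  simp only [Finset.mem_univ, true_implies] at h1 h2
  let C : Fin w → Finset P := fun i => Finset.univ.filter (fun x => col x = i)
  choose Q hQ1 hQ2 using fun i => split_aux _ (C i) rfl
  have hmem : ∀ x, x ∈ C ⟨col x, h1 x⟩ := fun x => by simp [C]
  have hsum : ∑ i, (C i).card = n := by
    rw [← hn, ← Finset.card_univ]
    rw [← Finset.card_biUnion]
    · congr 1
      ext x
      simp only [Finset.mem_biUnion, Finset.mem_univ, true_and, iff_true]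
      exact ⟨_, hmem x⟩
    · intro i _ j _ hij
      refine Finset.disjoint_left.2 ?_
      intro x hx hx'
      simp [C] at hx hx'
      exact hij (Fin.ext (hx.symm.trans hx'))
  refine ⟨Σ i, (Q i).parts, inferInstance, fun p => p.2.1,
    fun x => ⟨⟨col x, h1 x⟩, ⟨(Q _).part x, (Q _).part_mem.2 (hmem x)⟩⟩, ?_, ?_, ?_, ?_, ?_⟩
  · rintro x ⟨i, p, hp⟩
    constructor
    · intro hx
      have hx : x ∈ p := hx
      have hxC : x ∈ C i := (Q i).le hp hx
      have : i = ⟨col x, h1 x⟩ := by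
        simp [C] at hxC; exact Fin.ext hxC.symm
      subst this
      have h9 := (Q ⟨col x, h1 x⟩).part_eq_of_mem hp hx
      subst h9
      rfl
    · intro h
      rw [← h]
      exact (Q _).mem_part (hmem x)
  · intro x y h
    have := congrArg Sigma.fst h
    exact h2 x y (congrArg Fin.val this)
  · rintro ⟨i, p, hp⟩
    exact hQ1 i p hp
  · rw [Fintype.card_sigma, ← hsum]
    apply Finset.sum_le_sum
    intro i _
    rw [Fintype.card_coe]
    exact (Q i).card_parts_le_card
  · rw [Fintype.prod_sigma]
    have h3 : ∀ i, ∏ p : (Q i).parts, (p.1.card + 1) = ∏ p ∈ (Q i).parts, (p.card + 1) := by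
      intro i
      exact Finset.prod_coe_sort (Q i).parts (fun p => p.card + 1)
    simp only [h3]
    have h4 : ∏ i, (16 * 3 ^ (C i).card * ∏ p ∈ (Q i).parts, (p.card + 1)) ≤
        ∏ i : Fin w, (27 * 4 ^ (C i).card) := Finset.prod_le_prod' (fun i _ => hQ2 i)
    simp only [Finset.prod_mul_distrib, Finset.prod_const, Finset.card_univ, Fintype.card_fin,
      Finset.prod_pow_eq_pow_sum, hsum] at h4
    set X := ∏ i, ∏ p ∈ (Q i).parts, (p.card + 1)
    obtain ⟨d, hd⟩ : ∃ d, 3 * w = n + d := ⟨3 * w - n, by omega⟩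
    have h5 : (3:ℕ)^d ≤ 4^d := Nat.pow_le_pow_left (by norm_num) d
    have h6 : 16^w * 27^w * X ≤ 16^w * 27^w * 4^w := by
      calc 16^w * 27^w * X = 16^w * (3^n * 3^d) * X := by
            rw [← pow_add, ← hd, pow_mul]; norm_num
        _ = (16^w * 3^n * X) * 3^d := by ring
        _ ≤ (27^w * 4^n) * 4^d := Nat.mul_le_mul h4 h5
        _ = 27^w * (4^(3*w)) := by rw [hd, pow_add]; ring
        _ = 27^w * (16^w * 4^w) := by rw [← mul_pow, pow_mul]; norm_num
        _ = _ := by ring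
    exact Nat.le_of_mul_le_mul_left h6 (by positivity)

theorem fam (n w : ℕ) (c : Fin 9 → ℕ) : ∃ F : Finset (Finset (Fin n)), F.card ≤ 4 ^ w ∧
    ∀ (P : Type) [Fintype P] [PartialOrder P] (ι : Type) [Fintype ι] (S : ι → Finset P)
      (g : P → ι) (k : ι → Fin 9), Fintype.card P = n →
      (∀ x i, x ∈ S i ↔ g x = i) → (∀ x y, g x = g y → x ≤ y ∨ y ≤ x) →
      (∀ i, (S i).card = k i) → (∀ j, Nat.card {i // k i = j} = c j) →
      ∏ i, ((S i).card + 1) ≤ 4 ^ w →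
      ∃ f : P → Finset (Fin n), (∀ x, f x ∈ F) ∧ ∀ x y : P, x ≤ y ↔ f x ⊆ f y := by
  classical
  by_cases hv : ∏ p : (Σ j : Fin 9, Fin (c j)), (p.1.val + 1) ≤ 4 ^ w ∧
      Fintype.card (Σ p : (Σ j : Fin 9, Fin (c j)), Fin p.1.val) = n
  swap
  · refine ⟨∅, by simp, ?_⟩
    intro P _ _ ι _ S g k hP hg hch hk hc hprod
    exfalso
    apply hv
    let φ : (Σ j : Fin 9, Fin (c j)) ≃ ι :=
      (Equiv.sigmaCongrRight (fun j => (finCongr (hc j).symm).trans (Finite.equivFin _).symm)).trans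
        (Equiv.sigmaFiberEquiv k)
    have hφ : ∀ p, k (φ p) = p.1 := by
      rintro ⟨j, t⟩
      exact ((Finite.equivFin {i // k i = j}).symm (finCongr (hc j).symm t)).2
    constructor
    · refine le_trans (le_of_eq ?_) hprod
      rw [← φ.prod_comp]
      refine Finset.prod_congr rfl (fun p _ => ?_)
      rw [hk, hφ]
    · rw [Fintype.card_sigma]
      simp only [Fintype.card_fin]
      rw [← hP, ← Finset.card_univ,
        Finset.card_eq_sum_card_fiberwise (f := g) (t := Finset.univ) (by simp), ← φ.sum_comp]
      refine Finset.sum_congr rfl (fun p _ => ?_)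
      rw [← hφ p, ← hk]
      congr 1
      ext x; simp [hg]
  obtain ⟨hv1, hv2⟩ := hv
  let E : (Σ p : (Σ j : Fin 9, Fin (c j)), Fin p.1.val) ≃ Fin n := Fintype.equivFinOfCardEq hv2
  let mk : (∀ p : (Σ j : Fin 9, Fin (c j)), Fin (p.1.val + 1)) → Finset (Fin n) := fun h =>
    Finset.univ.filter (fun z => (E.symm z).2.val < (h (E.symm z).1).val)
  refine ⟨Finset.univ.image mk, ?_, ?_⟩
  · refine Finset.card_image_le.trans ?_
    rw [Finset.card_univ, Fintype.card_pi]
    simpa using hv1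
  intro P _ _ ι _ S g k hP hg hch hk hc hprod
  let φ : (Σ j : Fin 9, Fin (c j)) ≃ ι :=
    (Equiv.sigmaCongrRight (fun j => (finCongr (hc j).symm).trans (Finite.equivFin _).symm)).trans
      (Equiv.sigmaFiberEquiv k)
  have hφ : ∀ p, k (φ p) = p.1 := by
    rintro ⟨j, t⟩
    exact ((Finite.equivFin {i // k i = j}).symm (finCongr (hc j).symm t)).2
  have hSc : ∀ p, (S (φ p)).card = p.1.val := fun p => by rw [hk, hφ]
  let rk : P → ℕ := fun x => ((S (g x)).filter (· < x)).card
  have hrk : ∀ x, rk x < (φ.symm (g x)).1.val := by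
    intro x
    rw [← hSc, Equiv.apply_symm_apply]
    apply Finset.card_lt_card
    rw [Finset.filter_ssubset]
    exact ⟨x, (hg x _).2 rfl, lt_irrefl _⟩
  have hrkmono : ∀ x y, g x = g y → x < y → rk x < rk y := by
    intro x y hxy hlt
    apply Finset.card_lt_card
    rw [Finset.ssubset_iff_of_subset]
    · refine ⟨x, ?_, ?_⟩
      · simp [hg, hxy, hlt]
      · simp
    · intro z hz
      simp only [Finset.mem_filter, hg] at hz ⊢
      exact ⟨hz.1.trans hxy, hz.2.trans hlt⟩
  let G0 : P → (Σ p : (Σ j : Fin 9, Fin (c j)), Fin p.1.val) :=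
    fun x => ⟨φ.symm (g x), ⟨rk x, hrk x⟩⟩
  have hG0 : Function.Injective G0 := by
    intro x y h
    have h1 : g x = g y := φ.symm.injective (congrArg Sigma.fst h)
    have h2 : rk x = rk y := by
      have := congrArg (fun q : (Σ p : (Σ j : Fin 9, Fin (c j)), Fin p.1.val) => q.2.val) h
      exact this
    by_contra hne
    rcases hch x y h1 with h3 | h3
    · have := hrkmono x y h1 (lt_of_le_of_ne h3 hne); omega
    · have := hrkmono y x h1.symm (lt_of_le_of_ne h3 (Ne.symm hne)); omega
  have hbij : Function.Bijective G0 := by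
    rw [Fintype.bijective_iff_injective_and_card]
    exact ⟨hG0, by rw [hP, hv2]⟩
  let Ge : P ≃ Fin n := (Equiv.ofBijective G0 hbij).trans E
  refine ⟨fun x => (Finset.univ.filter (· ≤ x)).map Ge.toEmbedding, ?_, ?_⟩
  · intro x
    refine Finset.mem_image.2 ⟨fun p => ⟨((S (φ p)).filter (· ≤ x)).card, ?_⟩, Finset.mem_univ _, ?_⟩
    · have := Finset.card_filter_le (S (φ p)) (· ≤ x)
      rw [hSc] at this
      omega
    · ext z
      obtain ⟨y, rfl⟩ := Ge.surjective z
      have hE : E.symm (Ge y) = G0 y := by simp [Ge]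
      simp only [mk, Finset.mem_filter, Finset.mem_univ, true_and, hE, Finset.mem_map_equiv,
        Equiv.symm_apply_apply]
      have hE2 : (E.symm (Ge y)).2.val = rk y := by rw [hE]
      rw [hE2]
      change rk y < ((S (φ (φ.symm (g y)))).filter (· ≤ x)).card ↔ y ≤ x
      rw [Equiv.apply_symm_apply]
      constructor
      · intro hlt
        by_contra hyx
        refine absurd (Finset.card_le_card ?_) (not_le.2 hlt)
        intro z hz
        simp only [Finset.mem_filter, hg] at hz ⊢
        refine ⟨hz.1, ?_⟩
        rcases hch z y hz.1 with h | h
        · exact lt_of_le_of_ne h (by rintro rfl; exact hyx hz.2)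
        · exact absurd (h.trans hz.2) hyx
      · intro hyx
        apply Finset.card_lt_card
        rw [Finset.ssubset_iff_of_subset]
        · exact ⟨y, by simp [hg, hyx], by simp⟩
        · intro z hz
          simp only [Finset.mem_filter, hg] at hz ⊢
          exact ⟨hz.1, hz.2.le.trans hyx⟩
  · intro x y
    rw [Finset.map_subset_map]
    constructor
    · intro h z hz
      simp only [Finset.mem_filter, Finset.mem_univ, true_and] at hz ⊢
      exact hz.trans h
    · intro h
      have := @h x (by simp)
      simpa using this

theorem big {P : Type} [Fintype P] [PartialOrder P] [DecidableEq P] (n w s : ℕ)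
    (hn : Fintype.card P = n) (hs : n ≤ 2 ^ s) (hs1 : 1 ≤ s)
    (A0 : Finset P) (hA0 : IsAntichain (· ≤ ·) (A0 : Set P)) (hA0w : w ≤ A0.card) :
    ∃ (T : Type) (_ : Fintype T) (f : P → Finset T), Fintype.card T ≤ n - w + 2 * s ∧
      ∀ x y : P, x ≤ y ↔ f x ⊆ f y := by
  classical
  obtain ⟨A, hA, hmax⟩ := (Finset.univ.filter
    (fun A : Finset P => IsAntichain (· ≤ ·) (A : Set P))).exists_max_image Finset.card
      ⟨A0, by simpa using hA0⟩
  have hAw : w ≤ A.card := hA0w.trans (hmax A0 (by simpa using hA0))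
  replace hA : IsAntichain (· ≤ ·) (A : Set P) := by simpa using hA
  let U : P → Prop := fun x => ∃ a ∈ A, a < x
  have hmax' : ∀ x, x ∉ A → ¬ U x → ∃ a ∈ A, x < a := by
    intro x hx hU
    by_contra hcon
    push Not at hcon
    have h1 : IsAntichain (· ≤ ·) ((insert x A : Finset P) : Set P) := by
      intro y hy z hz hne hle
      simp only [Finset.coe_insert, Set.mem_insert_iff, Finset.mem_coe] at hy hz
      rcases hy with rfl | hy <;> rcases hz with rfl | hz
      · exact hne rfl
      · exact hcon z hz (lt_of_le_of_ne hle hne)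
      · exact hU ⟨y, hy, lt_of_le_of_ne hle hne⟩
      · exact hA hy hz hne hle
    have h2 := hmax (insert x A) (Finset.mem_filter.2 ⟨Finset.mem_univ _, h1⟩)
    rw [Finset.card_insert_of_notMem hx] at h2
    omega
  have hUA : ∀ y ∈ A, ¬ U y := by
    rintro y hy ⟨a, ha, hlt⟩
    exact hA ha hy hlt.ne hlt.le
  let r : P → ℕ := fun x => (Fintype.equivFin P x).val
  have hr : Function.Injective r := fun x y h => (Fintype.equivFin P).injective (Fin.ext h)
  have hrs : ∀ x, r x < 2 ^ s := fun x => by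
    have := (Fintype.equivFin P x).2
    have h2 : r x < Fintype.card P := this
    omega
  let pr : P → ({x // x ∉ A} ⊕ (Fin s × Bool)) → Prop := fun x t =>
    Sum.elim (fun b => if U b.1 then ¬ x ≤ b.1 else b.1 ≤ x)
      (fun q => U x ∨ (x ∈ A ∧ (r x).testBit q.1 = q.2)) t
  have key : ∀ x y, x ≤ y ↔ ∀ t, pr x t → pr y t := by
    intro x y
    constructor
    · rintro hxy (b | ⟨i, v⟩) h
      · simp only [pr, Sum.elim_inl] at h ⊢
        split_ifs at h ⊢ with hb
        · exact fun h' => h (hxy.trans h')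
        · exact h.trans hxy
      · simp only [pr, Sum.elim_inr] at h ⊢
        rcases h with ⟨a, ha, hlt⟩ | ⟨hxA, hb⟩
        · exact Or.inl ⟨a, ha, hlt.trans_le hxy⟩
        · rcases hxy.eq_or_lt with rfl | hlt
          · exact Or.inr ⟨hxA, hb⟩
          · exact Or.inl ⟨x, hxA, hlt⟩
    · intro h
      by_contra hxy
      have hyU : ¬ U y := by
        intro hU
        have hyA : y ∉ A := fun hy => hUA y hy hU
        have := h (Sum.inl ⟨y, hyA⟩)
        simp only [pr, Sum.elim_inl, hU, if_true] at this
        exact this hxy le_rfl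
      have hxU : x ∈ A ∨ U x := by
        by_contra hcon
        push Not at hcon
        have := h (Sum.inl ⟨x, hcon.1⟩)
        simp only [pr, Sum.elim_inl, hcon.2, if_false] at this
        exact hxy (this le_rfl)
      by_cases hU : U x
      · have := h (Sum.inr (⟨0, hs1⟩, !(r y).testBit 0))
        simp only [pr, Sum.elim_inr] at this
        rcases this (Or.inl hU) with h' | h'
        · exact hyU h'
        · simp at h'
      · have hxA : x ∈ A := hxU.resolve_right hU
        have hne : r x ≠ r y := fun h' => hxy (hr h').le
        apply hne
        apply Nat.eq_of_testBit_eq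
        intro i
        by_cases hi : i < s
        · have := h (Sum.inr (⟨i, hi⟩, (r x).testBit i))
          rcases this (Or.inr ⟨hxA, rfl⟩) with h' | h'
          · exact absurd h' hyU
          · exact h'.2.symm
        · have hle : 2 ^ s ≤ 2 ^ i := Nat.pow_le_pow_right (by norm_num) (by omega)
          rw [Nat.testBit_lt_two_pow ((hrs x).trans_le hle),
            Nat.testBit_lt_two_pow ((hrs y).trans_le hle)]
  refine ⟨{x // x ∉ A} ⊕ (Fin s × Bool), inferInstance,
    fun x => Finset.univ.filter (pr x), ?_, ?_⟩
  · rw [Fintype.card_sum, Fintype.card_prod, Fintype.card_fin, Fintype.card_bool,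
      Fintype.card_subtype_compl, hn]
    simp only [Fintype.card_coe]
    omega
  · intro x y
    rw [key]
    simp [Finset.subset_iff]

theorem comb (n : ℕ) (hn : 1 ≤ n) : ∃ V : Finset (Finset (Fin n)),
    V.card ≤ 4 ^ ((n + 2) / 3) * (n + 1) ^ 10 ∧
    ∀ (P : Type) [Fintype P] [PartialOrder P], Fintype.card P = n →
      ∃ f : P → Finset (Fin n), (∀ x, f x ∈ V) ∧ ∀ x y : P, x ≤ y ↔ f x ⊆ f y := by
  classical
  set w := (n + 2) / 3 with hw
  set s := Nat.log 2 n + 1 with hs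
  have hns : n ≤ 2 ^ s := (Nat.lt_pow_succ_log_self (by norm_num) n).le
  have hs2 : 2 ^ s ≤ 2 * n := by
    rw [hs, pow_succ]
    have := Nat.pow_log_le_self 2 (x := n) (by omega)
    omega
  choose F hF1 hF2 using fam n w
  let V1 : Finset (Finset (Fin n)) :=
    (Finset.univ : Finset (Fin 9 → Fin (n + 1))).biUnion (fun c => F (fun j => (c j).val))
  let V2 : Finset (Finset (Fin n)) :=
    (Finset.univ.filter (fun i : Fin n => i.val < n - w + 2 * s)).powerset
  have hV1 : V1.card ≤ (n + 1) ^ 9 * 4 ^ w := by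
    refine Finset.card_biUnion_le.trans ?_
    refine (Finset.sum_le_sum (fun c _ => hF1 _)).trans ?_
    simp
  have hV2 : V2.card ≤ 4 ^ w * (4 * n ^ 2) := by
    rw [Finset.card_powerset]
    have h1 : (Finset.univ.filter (fun i : Fin n => i.val < n - w + 2 * s)).card
        ≤ 2 * w + 2 * s := by
      have h3 : (Finset.univ.filter (fun i : Fin n => i.val < n - w + 2 * s)).card
        ≤ (Finset.range (n - w + 2 * s)).card :=
        Finset.card_le_card_of_injOn Fin.val (by intro i hi; simpa using hi)
          (Fin.val_injective.injOn)
      rw [Finset.card_range] at h3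
      omega
    calc 2 ^ _ ≤ 2 ^ (2 * w + 2 * s) := Nat.pow_le_pow_right (by norm_num) h1
      _ = 4 ^ w * (2 ^ s) ^ 2 := by rw [pow_add, pow_mul, mul_comm 2 s, pow_mul]; norm_num
      _ ≤ 4 ^ w * (2 * n) ^ 2 := by gcongr
      _ = _ := by ring
  refine ⟨V1 ∪ V2, ?_, ?_⟩
  · refine (Finset.card_union_le _ _).trans ?_
    have h1 : 4 * n ^ 2 ≤ (n + 1) ^ 9 := by
      calc 4 * n ^ 2 ≤ 2 ^ 7 * (n + 1) ^ 2 := by nlinarith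
        _ ≤ (n + 1) ^ 7 * (n + 1) ^ 2 := by gcongr; omega
        _ = _ := by ring
    calc V1.card + V2.card ≤ (n + 1) ^ 9 * 4 ^ w + 4 ^ w * (n + 1) ^ 9 :=
          add_le_add hV1 (hV2.trans (Nat.mul_le_mul_left _ h1))
      _ = 4 ^ w * ((n + 1) ^ 9 * 2) := by ring
      _ ≤ 4 ^ w * ((n + 1) ^ 9 * (n + 1)) := by gcongr; omega
      _ = _ := by ring
  · intro P _ _ hP
    by_cases hA : ∀ A : Finset P, IsAntichain (· ≤ ·) (A : Set P) → A.card ≤ w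
    · obtain ⟨ι, _, S, g, h1, h2, h3, h4, h5⟩ := decomp n w hP (by omega) hA
      let k : ι → Fin 9 := fun i => ⟨(S i).card, by have := h3 i; omega⟩
      let c : Fin 9 → Fin (n + 1) := fun j => ⟨Nat.card {i // k i = j}, by
        rw [Nat.card_eq_fintype_card]
        have := Fintype.card_subtype_le (fun i => k i = j)
        omega⟩
      obtain ⟨f, hf1, hf2⟩ := hF2 (fun j => (c j).val) P ι S g k hP h1 h2 (fun _ => rfl)
        (fun _ => rfl) h5
      exact ⟨f, fun x => Finset.mem_union_left _ (Finset.mem_biUnion.2 ⟨c, Finset.mem_univ _, hf1 x⟩), hf2⟩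
    · push Not at hA
      obtain ⟨A, hA1, hA2⟩ := hA
      by_cases hm : n ≤ n - w + 2 * s
      · let e := Fintype.equivFinOfCardEq hP
        refine ⟨fun x => (Finset.univ.filter (· ≤ x)).map e.toEmbedding, ?_, ?_⟩
        · intro x
          refine Finset.mem_union_right _ (Finset.mem_powerset.2 ?_)
          intro i _
          simp only [Finset.mem_filter, Finset.mem_univ, true_and]
          have := i.2
          omega
        · intro x y
          rw [Finset.map_subset_map]
          constructor
          · intro h z hz
            simp only [Finset.mem_filter, Finset.mem_univ, true_and] at hz ⊢
            exact hz.trans h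
          · intro h
            have := @h x (by simp)
            simpa using this
      · obtain ⟨T, _, f, hT, hf⟩ := big n w s hP hns (by omega) A hA1 hA2.le
        let e : T ↪ Fin n := (Fintype.equivFin T).toEmbedding.trans (Fin.castLEEmb (by omega))
        refine ⟨fun x => (f x).map e, ?_, ?_⟩
        · intro x
          refine Finset.mem_union_right _ (Finset.mem_powerset.2 ?_)
          intro i hi
          obtain ⟨t, -, rfl⟩ := Finset.mem_map.1 hi
          simp only [Finset.mem_filter, Finset.mem_univ, true_and]
          have := (Fintype.equivFin T t).2
          have h2 : (e t).val = (Fintype.equivFin T t).val := rfl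
          omega
        · intro x y
          rw [Finset.map_subset_map]
          exact hf x y

/-- Main theorem: there is `C > 0` such that for every `n ≥ 1` there is a family
`V ⊆ 2^[n]` with `|V| ≤ 2 ^ (2n/3 + C√n)` into which every `n`-element poset embeds. -/
theorem stmt_12 :
    ∃ C : ℝ, 0 < C ∧ ∀ n : ℕ, 1 ≤ n →
      ∃ V : Finset (Finset (Fin n)),
        (V.card : ℝ) ≤ (2 : ℝ) ^ (2 * (n : ℝ) / 3 + C * Real.sqrt n) ∧
        ∀ (P : Type) [Fintype P] [PartialOrder P], Fintype.card P = n →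
          ∃ f : P → Finset (Fin n), (∀ x, f x ∈ V) ∧
            ∀ x y : P, x ≤ y ↔ f x ⊆ f y := by
  refine ⟨22, by norm_num, ?_⟩
  intro n hn
  obtain ⟨V, hV, h⟩ := comb n hn
  refine ⟨V, ?_, h⟩
  have hn1 : (1:ℝ) ≤ n := by exact_mod_cast hn
  have hsq : 1 ≤ Real.sqrt n := Real.one_le_sqrt.2 hn1
  set q := Real.sqrt n with hq
  have hqq : q * q = n := Real.mul_self_sqrt (by positivity)
  have h1 : 1 + q ≤ (2:ℝ) ^ q := by
    have := one_add_mul_self_le_rpow_one_add (s := 1) (by norm_num) hsq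
    norm_num at this
    exact this
  have h2 : (n:ℝ) + 1 ≤ ((2:ℝ) ^ q) ^ 2 := by nlinarith
  have h3 : ((n:ℝ) + 1) ^ 10 ≤ (2:ℝ) ^ (20 * q) := by
    calc ((n:ℝ) + 1) ^ 10 ≤ (((2:ℝ) ^ q) ^ 2) ^ 10 := by gcongr
      _ = ((2:ℝ) ^ q) ^ (20:ℕ) := by rw [← pow_mul]
      _ = (2:ℝ) ^ (20 * q) := by
        rw [← Real.rpow_natCast, ← Real.rpow_mul (by norm_num)]
        congr 1; push_cast; ring
  have h4 : (4:ℝ) ^ ((n + 2) / 3) ≤ (2:ℝ) ^ (2 * (n:ℝ) / 3 + 2 * q) := by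
    have h5 : (4:ℝ) ^ ((n + 2) / 3) = (2:ℝ) ^ (((2 * ((n + 2) / 3) : ℕ)) : ℝ) := by
      rw [Real.rpow_natCast, pow_mul]; norm_num
    rw [h5]
    apply Real.rpow_le_rpow_of_exponent_le (by norm_num)
    have h6 : 3 * (2 * ((n + 2) / 3)) ≤ 2 * n + 4 := by omega
    have h7 : (3:ℝ) * ((2 * ((n + 2) / 3) : ℕ) : ℝ) ≤ 2 * n + 4 := by exact_mod_cast h6
    linarith
  calc (V.card : ℝ) ≤ (4:ℝ) ^ ((n + 2) / 3) * ((n:ℝ) + 1) ^ 10 := by exact_mod_cast hV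
    _ ≤ (2:ℝ) ^ (2 * (n:ℝ) / 3 + 2 * q) * (2:ℝ) ^ (20 * q) := by gcongr
    _ = _ := by rw [← Real.rpow_add (by norm_num)]; congr 1; ring
end
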